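/- Let g be a solvable Lie algebra and let h ⊆ g be an ideal with h ⊇ [g,g] that is nilpotent with nilindex p. Let f : 𝒳 × 𝒲 → 𝒳 belong to class-𝒜 with linear part A, such that (i) for every W ∈ 𝒲, f(X,W) = 0 if and only if X = 0, and (ii) for every i ≥ 1 the subspace (h^(i))^n ⊆ 𝒳 is invariant under f (equivalently, under A). Suppose A is Schur (ρ(A) < 1). Then there exists β > 0 such that for every exogenous signal W with dist(W[k], h^r) → 0 as k → ∞ and ‖W[k]‖ ≤ β for all k ≥ 0, the origin of 𝒳 is globally asymptotically stable for the system X[k+1] = f(X[k],W[k]): it is Lyapunov stable and every solution converges to 0 regardless of initial condition. -/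

import Mathlib

open scoped BigOperators

/-- Words of length at least `2` over `m` letters. -/
def Word (m : ℕ) : Type := {l : List (Fin m) // 2 ≤ l.length}

section bracket

variable {g : Type*} [AddCommGroup g] [Module ℝ g]

/-- Right-nested evaluation `[Y ω₁, [Y ω₂, [… , Y ω_{|ω|}]⋯]]` of a word with respect to a
bilinear bracket `B`. -/
def wordEval (B : g →ₗ[ℝ] g →ₗ[ℝ] g) {m : ℕ} (Y : Fin m → g) : List (Fin m) → g
  | [] => 0
  | [i] => Y i
  | i :: j :: l => B (Y i) (wordEval B Y (j :: l))

/-- The `j`-th letter: `X j` for `j < n`, and `W (j - n)` otherwise. -/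
def letter {n r : ℕ} (X : Fin n → g) (W : Fin r → g) (j : Fin (n + r)) : g :=
  if h : (j : ℕ) < n then X ⟨j, h⟩ else W ⟨(j : ℕ) - n, by have := j.isLt; omega⟩

/-- Bracket of two submodules: the span of the pairwise brackets. -/
def bSpan (B : g →ₗ[ℝ] g →ₗ[ℝ] g) (S T : Submodule ℝ g) : Submodule ℝ g :=
  Submodule.span ℝ {z | ∃ x ∈ S, ∃ y ∈ T, z = B x y}

/-- `lcs B h i` is the `(i+1)`-st term `h^(i+1)` of the lower central series of `h`:
`h^(1) = h`, `h^(i+1) = [h^(i), h]`. -/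
def lcs (B : g →ₗ[ℝ] g →ₗ[ℝ] g) (h : Submodule ℝ g) : ℕ → Submodule ℝ g
  | 0 => h
  | i + 1 => bSpan B (lcs B h i) h

/-- The derived series of `g` with respect to the bracket `B`. -/
def derSeries (B : g →ₗ[ℝ] g →ₗ[ℝ] g) : ℕ → Submodule ℝ g
  | 0 => ⊤
  | i + 1 => bSpan B (derSeries B i) (derSeries B i)

end bracket

/-- The product norm `‖(Z₁, …, Z_m)‖ = Σ_i ‖Z_i‖`. -/
noncomputable def pnorm {g : Type*} [NormedAddCommGroup g] {m : ℕ} (X : Fin m → g) : ℝ :=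
  ∑ i, ‖X i‖

/-- The spectral radius of a (continuous) linear endomorphism, via Gelfand's formula. -/
noncomputable def specRad {E : Type*} [NormedAddCommGroup E] [NormedSpace ℝ E]
    (A : E →L[ℝ] E) : ℝ :=
  Filter.limsup (fun k : ℕ => ‖A ^ k‖ ^ (1 / (k : ℝ))) Filter.atTop

section letters

variable {g : Type*} [AddCommGroup g]

lemma letter_add {n r : ℕ} (Z Y : Fin n → g) (W : Fin r → g) :
    letter (Z + Y) W = letter Z 0 + letter Y W := by
  funext j
  simp only [letter, Pi.add_apply]
  split <;> simp

lemma letter_sub {n r : ℕ} (X Y : Fin n → g) (W V : Fin r → g) (i : Fin (n + r)) :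
    letter X W i - letter Y V i = letter (X - Y) (W - V) i := by
  unfold letter
  split <;> simp

end letters

section algebra

variable {g : Type*} [AddCommGroup g] [Module ℝ g]

lemma letter_smul {n r : ℕ} (t : ℝ) (Z : Fin n → g) :
    letter (t • Z) (0 : Fin r → g) = t • letter Z 0 := by
  funext j
  simp only [letter, Pi.smul_apply]
  split <;> simp

variable {B : g →ₗ[ℝ] g →ₗ[ℝ] g}

lemma bracket_swap (hBalt : ∀ x : g, B x x = 0) (x y : g) : B x y = -B y x := by
  have h := hBalt (x + y)
  simp only [map_add, LinearMap.add_apply, hBalt, zero_add, add_zero] at h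
  exact eq_neg_of_add_eq_zero_right h

lemma bracket_mem_bSpan {S T : Submodule ℝ g} {x y : g} (hx : x ∈ S) (hy : y ∈ T) :
    B x y ∈ bSpan B S T :=
  Submodule.subset_span ⟨x, hx, y, hy, rfl⟩

/-- The bracket of two ideals is an ideal. -/
lemma bSpan_ideal (hBjac : ∀ x y z : g, B x (B y z) = B (B x y) z + B y (B x z))
    {S T : Submodule ℝ g} (hS : ∀ x, ∀ y ∈ S, B x y ∈ S) (hT : ∀ x, ∀ y ∈ T, B x y ∈ T) :
    ∀ x, ∀ y ∈ bSpan B S T, B x y ∈ bSpan B S T := by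
  intro x y hy
  induction hy using Submodule.span_induction with
  | mem z hz =>
    obtain ⟨a, ha, b, hb, rfl⟩ := hz
    rw [hBjac]
    exact add_mem (bracket_mem_bSpan (hS x a ha) hb) (bracket_mem_bSpan ha (hT x b hb))
  | zero => simp
  | add y z _ _ hy hz => rw [map_add]; exact add_mem hy hz
  | smul t y _ hy => rw [map_smul]; exact Submodule.smul_mem _ _ hy

lemma lcs_ideal (hBjac : ∀ x y z : g, B x (B y z) = B (B x y) z + B y (B x z))
    {h : Submodule ℝ g} (hIdeal : ∀ (x : g), ∀ y ∈ h, B x y ∈ h) (i : ℕ) :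
    ∀ x, ∀ y ∈ lcs B h i, B x y ∈ lcs B h i := by
  induction i with
  | zero => exact hIdeal
  | succ i ih => exact bSpan_ideal hBjac ih hIdeal

lemma lcs_le {h : Submodule ℝ g} (hIdeal : ∀ (x : g), ∀ y ∈ h, B x y ∈ h) (i : ℕ) :
    lcs B h i ≤ h := by
  cases i with
  | zero => exact le_rfl
  | succ i =>
    refine Submodule.span_le.2 ?_
    rintro _ ⟨x, -, y, hy, rfl⟩
    exact hIdeal x y hy

/-- Changing the letters by elements of an ideal changes a word by an element of that ideal. -/
lemma wordEval_sub_mem (hBalt : ∀ x : g, B x x = 0) {L : Submodule ℝ g}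
    (hL : ∀ x, ∀ y ∈ L, B x y ∈ L) {m : ℕ} {x y : Fin m → g} (hxy : ∀ i, x i - y i ∈ L)
    (l : List (Fin m)) : wordEval B x l - wordEval B y l ∈ L := by
  induction l with
  | nil => simp [wordEval]
  | cons i l ih =>
    cases l with
    | nil => simpa [wordEval] using hxy i
    | cons j l =>
      have e : wordEval B x (i :: j :: l) - wordEval B y (i :: j :: l)
          = B (x i) (wordEval B x (j :: l) - wordEval B y (j :: l))
            - B (wordEval B y (j :: l)) (x i - y i) := by
        simp only [wordEval, map_sub]
        rw [bracket_swap hBalt (wordEval B y (j :: l)) (x i),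
          bracket_swap hBalt (wordEval B y (j :: l)) (y i)]
        abel
      rw [e]
      exact sub_mem (hL _ _ ih) (hL _ _ (hxy i))

/-- Modulo `[L, h]`, the increment of a word along `z ∈ L` is linear in `z` and only depends on
the base point modulo `h`. -/
lemma wordEval_increment_mem (hBalt : ∀ x : g, B x x = 0)
    (hBjac : ∀ x y z : g, B x (B y z) = B (B x y) z + B y (B x z))
    {h L : Submodule ℝ g} (hh : ∀ x, ∀ y ∈ h, B x y ∈ h)
    (hL : ∀ x, ∀ y ∈ L, B x y ∈ L) (hLh : L ≤ h) {m : ℕ} {y y' z : Fin m → g}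
    (hz : ∀ i, z i ∈ L) (hyy : ∀ i, y i - y' i ∈ h) (t : ℝ) (l : List (Fin m)) :
    t • (wordEval B (z + y) l - wordEval B y l)
      - (wordEval B (t • z + y') l - wordEval B y' l) ∈ bSpan B L h := by
  induction l with
  | nil => simp [wordEval]
  | cons i l ih =>
    cases l with
    | nil => simp [wordEval]
    | cons j l =>
      have hD : wordEval B (z + y) (j :: l) - wordEval B y (j :: l) ∈ L :=
        wordEval_sub_mem hBalt hL (fun i => by simpa using hz i) _
      have hD' : wordEval B (t • z + y') (j :: l) - wordEval B y' (j :: l) ∈ L :=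
        wordEval_sub_mem hBalt hL (fun i => by simpa using L.smul_mem t (hz i)) _
      have hE : wordEval B y (j :: l) - wordEval B y' (j :: l) ∈ h :=
        wordEval_sub_mem hBalt hh hyy _
      have e : t • (wordEval B (z + y) (i :: j :: l) - wordEval B y (i :: j :: l))
            - (wordEval B (t • z + y') (i :: j :: l) - wordEval B y' (i :: j :: l))
          = t • B (z i) (wordEval B (z + y) (j :: l) - wordEval B y (j :: l))
            - t • B (z i) (wordEval B (t • z + y') (j :: l) - wordEval B y' (j :: l))
            + t • B (z i) (wordEval B y (j :: l) - wordEval B y' (j :: l))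
            + B (y i) (t • (wordEval B (z + y) (j :: l) - wordEval B y (j :: l))
              - (wordEval B (t • z + y') (j :: l) - wordEval B y' (j :: l)))
            - B (wordEval B (t • z + y') (j :: l) - wordEval B y' (j :: l)) (y i - y' i) := by
        rw [bracket_swap hBalt _ (y i - y' i)]
        simp only [wordEval, map_sub, map_add, map_smul, LinearMap.add_apply, LinearMap.sub_apply,
          LinearMap.smul_apply, Pi.add_apply, Pi.smul_apply]
        module
      rw [e]
      exact sub_mem (add_mem (add_mem (sub_mem
        (Submodule.smul_mem _ _ (bracket_mem_bSpan (hz i) (hLh hD)))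
        (Submodule.smul_mem _ _ (bracket_mem_bSpan (hz i) (hLh hD'))))
        (Submodule.smul_mem _ _ (bracket_mem_bSpan (hz i) hE)))
        (bSpan_ideal hBjac hL hh _ _ ih)) (bracket_mem_bSpan hD' (hyy i))

lemma wordEval_mem_of_derived_le {h : Submodule ℝ g} (hDer : bSpan B ⊤ ⊤ ≤ h) {m : ℕ}
    (Y : Fin m → g) (ω : Word m) : wordEval B Y ω.1 ∈ h := by
  obtain ⟨_ | ⟨i, _ | ⟨j, l⟩⟩, hl⟩ := ω
  · simp at hl
  · simp at hl
  · exact hDer (bracket_mem_bSpan trivial trivial)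

end algebra

section norms

variable {g : Type*} [NormedAddCommGroup g]

lemma norm_letter_le {n r : ℕ} {X : Fin n → g} {W : Fin r → g} {D : ℝ} (hX : ‖X‖ ≤ D)
    (hW : ‖W‖ ≤ D) (i : Fin (n + r)) : ‖letter X W i‖ ≤ D := by
  unfold letter
  split
  · exact (norm_le_pi_norm X _).trans hX
  · exact (norm_le_pi_norm W _).trans hW

lemma norm_le_pnorm {m : ℕ} (X : Fin m → g) : ‖X‖ ≤ pnorm X := by
  refine (pi_norm_le_iff_of_nonneg (Finset.sum_nonneg fun _ _ => norm_nonneg _)).2 fun i => ?_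
  exact Finset.single_le_sum (f := fun i => ‖X i‖) (fun _ _ => norm_nonneg _) (Finset.mem_univ i)

lemma pnorm_le {m : ℕ} (X : Fin m → g) : pnorm X ≤ m * ‖X‖ := by
  calc pnorm X ≤ ∑ _i : Fin m, ‖X‖ := Finset.sum_le_sum fun i _ => norm_le_pi_norm X i
    _ = m * ‖X‖ := by simp

end norms

section estimates

variable {g : Type*} [NormedAddCommGroup g] [NormedSpace ℝ g] {B : g →ₗ[ℝ] g →ₗ[ℝ] g} {μ : ℝ}

lemma norm_wordEval_le (hμpos : 0 < μ) (hμ : ∀ x y : g, ‖B x y‖ ≤ μ * ‖x‖ * ‖y‖) {m : ℕ}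
    {Y : Fin m → g} {D : ℝ} (hY : ∀ i, ‖Y i‖ ≤ D) (i : Fin m) (l : List (Fin m)) :
    ‖wordEval B Y (i :: l)‖ ≤ μ ^ l.length * D ^ (l.length + 1) := by
  have hD : 0 ≤ D := (norm_nonneg _).trans (hY i)
  induction l generalizing i with
  | nil => simpa [wordEval] using hY i
  | cons j l ih =>
    calc ‖wordEval B Y (i :: j :: l)‖ ≤ μ * ‖Y i‖ * ‖wordEval B Y (j :: l)‖ := hμ _ _
      _ ≤ μ * D * (μ ^ l.length * D ^ (l.length + 1)) := by
        gcongr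
        · exact hY i
        · exact ih j
      _ = _ := by simp only [List.length_cons]; ring

lemma norm_wordEval_sub_le (hμpos : 0 < μ) (hμ : ∀ x y : g, ‖B x y‖ ≤ μ * ‖x‖ * ‖y‖) {m : ℕ}
    {X Y : Fin m → g} {D d : ℝ} (hX : ∀ i, ‖X i‖ ≤ D) (hY : ∀ i, ‖Y i‖ ≤ D)
    (hXY : ∀ i, ‖X i - Y i‖ ≤ d) (i : Fin m) (l : List (Fin m)) :
    ‖wordEval B X (i :: l) - wordEval B Y (i :: l)‖
      ≤ (l.length + 1) * (μ ^ l.length * D ^ l.length) * d := by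
  have hD : 0 ≤ D := (norm_nonneg _).trans (hX i)
  have hd : 0 ≤ d := (norm_nonneg _).trans (hXY i)
  induction l generalizing i with
  | nil => simpa [wordEval] using hXY i
  | cons j l ih =>
    have e : wordEval B X (i :: j :: l) - wordEval B Y (i :: j :: l)
        = B (X i - Y i) (wordEval B X (j :: l))
          + B (Y i) (wordEval B X (j :: l) - wordEval B Y (j :: l)) := by
      simp only [wordEval, map_sub, LinearMap.sub_apply]
      abel
    calc ‖wordEval B X (i :: j :: l) - wordEval B Y (i :: j :: l)‖
        ≤ μ * ‖X i - Y i‖ * ‖wordEval B X (j :: l)‖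
          + μ * ‖Y i‖ * ‖wordEval B X (j :: l) - wordEval B Y (j :: l)‖ := by
          rw [e]
          exact (norm_add_le _ _).trans (add_le_add (hμ _ _) (hμ _ _))
      _ ≤ μ * d * (μ ^ l.length * D ^ (l.length + 1))
          + μ * D * ((l.length + 1) * (μ ^ l.length * D ^ l.length) * d) := by
          gcongr
          · exact hXY i
          · exact norm_wordEval_le hμpos hμ hX j l
          · exact hY i
          · exact ih j
      _ = _ := by simp only [List.length_cons]; push_cast; ring

lemma succ_mul_half_pow_le (k : ℕ) : ((k : ℝ) + 2) * (1 / 2) ^ k ≤ 2 := by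
  induction k with
  | zero => norm_num
  | succ k ih =>
    have h : (0 : ℝ) ≤ (1 / 2) ^ k := by positivity
    have h' : (0 : ℝ) ≤ k * (1 / 2) ^ k := by positivity
    push_cast
    rw [pow_succ]
    nlinarith

/-- Near the origin, the nonlinear part of a class-`𝒜` map is Lipschitz in the state with
arbitrarily small constant. -/
lemma exists_lipschitz_nonlinear [CompleteSpace g] (hμpos : 0 < μ)
    (hμ : ∀ x y : g, ‖B x y‖ ≤ μ * ‖x‖ * ‖y‖) {n r : ℕ}
    {A : (Fin n → g) →L[ℝ] (Fin n → g)} {c : Word (n + r) → Fin n → ℝ}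
    {f : (Fin n → g) → (Fin r → g) → (Fin n → g)}
    (hsum : ∀ (X : Fin n → g) (W : Fin r → g) (j : Fin n),
      Summable (fun ω : Word (n + r) => ‖c ω j • wordEval B (letter X W) ω.1‖))
    (hfdef : ∀ X W j, f X W j = A X j + ∑' ω : Word (n + r), c ω j • wordEval B (letter X W) ω.1)
    (hclassA : ∃ ε > 0, ∀ (X : Fin n → g) (W : Fin r → g), pnorm X + pnorm W < ε →
      Summable (fun ω : Word (n + r) =>
        μ ^ (ω.1.length - 1) * ‖c ω‖ * (ω.1.map fun i => ‖letter X W i‖).prod))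
    {η : ℝ} (hη : 0 < η) :
    ∃ δ > 0, ∀ (X Y : Fin n → g) (W : Fin r → g), ‖X‖ ≤ δ → ‖Y‖ ≤ δ → ‖W‖ ≤ δ →
      ‖f X W - f Y W - A (X - Y)‖ ≤ η * ‖X - Y‖ := by
  rcases subsingleton_or_nontrivial g with hg | hg
  · refine ⟨1, one_pos, fun X Y W _ _ _ => ?_⟩
    rw [Subsingleton.elim (f X W - f Y W - A (X - Y)) 0, norm_zero]
    positivity
  obtain ⟨ε, hε, hs⟩ := hclassA
  set κ : ℝ := ε / (n + r + 1) with hκ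
  have hκpos : 0 < κ := by positivity
  obtain ⟨x, hx⟩ := exists_norm_eq g hκpos.le
  have hS : Summable (fun ω : Word (n + r) =>
      μ ^ (ω.1.length - 1) * ‖c ω‖ * κ ^ ω.1.length) := by
    have hlt : pnorm (fun _ : Fin n => x) + pnorm (fun _ : Fin r => x) < ε := by
      have e : ε = (n + r + 1) * κ := by rw [hκ]; field_simp
      simp only [pnorm, hx, Finset.sum_const, Finset.card_univ, Fintype.card_fin, nsmul_eq_mul]
      nlinarith
    refine (hs _ _ hlt).congr fun ω => ?_
    have : (fun i : Fin (n + r) => ‖letter (fun _ : Fin n => x) (fun _ : Fin r => x) i‖)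
        = fun _ => κ := by
      funext i
      simp [letter, hx]
    rw [this]
    simp
  set S := ∑' ω : Word (n + r), μ ^ (ω.1.length - 1) * ‖c ω‖ * κ ^ ω.1.length
  have hS0 : 0 ≤ S := tsum_nonneg fun ω => by positivity
  set θ : ℝ := min (1 / 2) (η * κ / (2 * (S + 1))) with hθ
  have hθpos : 0 < θ := by positivity
  have hθ2 : θ ≤ 1 / 2 := min_le_left _ _
  have hθη : 2 * θ / κ * S ≤ η := by
    have h1 : θ ≤ η * κ / (2 * (S + 1)) := min_le_right _ _
    rw [le_div_iff₀ (by positivity)] at h1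
    rw [div_mul_eq_mul_div, div_le_iff₀ hκpos]
    nlinarith
  refine ⟨θ * κ, by positivity, fun X Y W hX hY hW => ?_⟩
  refine (pi_norm_le_iff_of_nonneg (by positivity)).2 fun j => ?_
  have e : (f X W - f Y W - A (X - Y)) j
      = ∑' ω : Word (n + r), c ω j •
        (wordEval B (letter X W) ω.1 - wordEval B (letter Y W) ω.1) := by
    simp only [smul_sub]
    rw [(hsum X W j).of_norm.tsum_sub (hsum Y W j).of_norm]
    simp only [Pi.sub_apply, hfdef, map_sub]
    abel
  rw [e]
  have hbound : ∀ ω : Word (n + r),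
      ‖c ω j • (wordEval B (letter X W) ω.1 - wordEval B (letter Y W) ω.1)‖
        ≤ 2 * θ / κ * ‖X - Y‖ * (μ ^ (ω.1.length - 1) * ‖c ω‖ * κ ^ ω.1.length) := by
    rintro ⟨_ | ⟨i, _ | ⟨i', l⟩⟩, hl⟩
    · simp at hl
    · simp at hl
    · have hd : ∀ i, ‖letter X W i - letter Y W i‖ ≤ ‖X - Y‖ := fun i => by
        rw [letter_sub]
        exact norm_letter_le le_rfl (by simp) i
      have hw := norm_wordEval_sub_le hμpos hμ (norm_letter_le hX hW) (norm_letter_le hY hW) hd i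
        (i' :: l)
      have hpow : ((l.length : ℝ) + 2) * θ ^ l.length ≤ 2 :=
        (by gcongr : ((l.length : ℝ) + 2) * θ ^ l.length
          ≤ ((l.length : ℝ) + 2) * (1 / 2) ^ l.length).trans (succ_mul_half_pow_le _)
      rw [norm_smul]
      simp only [List.length_cons, Nat.add_sub_cancel] at hw ⊢
      calc ‖c ⟨i :: i' :: l, hl⟩ j‖ * _
          ≤ ‖c ⟨i :: i' :: l, hl⟩‖ * _ :=
            mul_le_mul (norm_le_pi_norm _ j) hw (norm_nonneg _) (norm_nonneg _)
        _ = (((l.length : ℝ) + 2) * θ ^ l.length) * (θ / κ * ‖X - Y‖ *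
            (μ ^ (l.length + 1) * ‖c ⟨i :: i' :: l, hl⟩‖ * κ ^ (l.length + 1 + 1))) := by
            push_cast
            field_simp
            ring
        _ ≤ 2 * (θ / κ * ‖X - Y‖ *
            (μ ^ (l.length + 1) * ‖c ⟨i :: i' :: l, hl⟩‖ * κ ^ (l.length + 1 + 1))) := by
            gcongr
        _ = _ := by ring
  refine (tsum_of_norm_bounded ((hS.hasSum).mul_left _) hbound).trans ?_
  calc 2 * θ / κ * ‖X - Y‖ * S = 2 * θ / κ * S * ‖X - Y‖ := by ring
    _ ≤ η * ‖X - Y‖ := by gcongr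

end estimates

section contraction

open Filter Topology

/-- A linear map of spectral radius less than one is a strict contraction for an equivalent norm. -/
lemma exists_adapted_norm {E : Type*} [NormedAddCommGroup E] [NormedSpace ℝ E] (A : E →L[ℝ] E)
    (hρ : specRad A < 1) :
    ∃ (q : Seminorm ℝ E) (C θ : ℝ), 0 < C ∧ 0 ≤ θ ∧ θ < 1 ∧ (∀ x, ‖x‖ ≤ q x) ∧
      (∀ x, q x ≤ C * ‖x‖) ∧ ∀ x, q (A x) ≤ θ * q x := by
  obtain ⟨θ, hθ, hθ1⟩ := exists_between (max_lt hρ one_pos)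
  have hθ0 : 0 < θ := (le_max_right _ _).trans_lt hθ
  have hbdd : IsBoundedUnder (· ≤ ·) atTop (fun k : ℕ => ‖A ^ k‖ ^ (1 / (k : ℝ))) := by
    refine ⟨‖A‖, ?_⟩
    rw [eventually_map]
    filter_upwards [eventually_gt_atTop 0] with k hk
    calc ‖A ^ k‖ ^ (1 / (k : ℝ)) ≤ (‖A‖ ^ k) ^ (1 / (k : ℝ)) :=
          Real.rpow_le_rpow (norm_nonneg _) (norm_pow_le' A hk) (by positivity)
      _ = ‖A‖ := by
          rw [one_div, Real.pow_rpow_inv_natCast (norm_nonneg _) hk.ne']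
  have hev := eventually_lt_of_limsup_lt ((le_max_left _ _).trans_lt hθ) hbdd
  obtain ⟨N, hN, hN0⟩ := (hev.and (eventually_gt_atTop 0)).exists
  have hAN : ‖A ^ N‖ ≤ θ ^ N := by
    have := pow_le_pow_left₀ (by positivity) hN.le N
    rwa [one_div, Real.rpow_inv_natCast_pow (norm_nonneg _) hN0.ne'] at this
  let q : Seminorm ℝ E := Seminorm.of (fun x => ∑ k ∈ Finset.range N, θ⁻¹ ^ k * ‖(A ^ k) x‖)
    (fun x y => by
      rw [← Finset.sum_add_distrib]
      refine Finset.sum_le_sum fun k _ => ?_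
      rw [map_add, ← mul_add]
      gcongr
      exact norm_add_le _ _)
    (fun t x => by
      rw [Finset.mul_sum]
      refine Finset.sum_congr rfl fun k _ => ?_
      rw [map_smul, norm_smul]
      ring)
  have hq : ∀ x, q x = ∑ k ∈ Finset.range N, θ⁻¹ ^ k * ‖(A ^ k) x‖ := fun _ => rfl
  refine ⟨q, ∑ k ∈ Finset.range N, θ⁻¹ ^ k * ‖A ^ k‖ + 1, θ, by positivity, hθ0.le, hθ1,
    fun x => ?_, fun x => ?_, fun x => ?_⟩
  · have := Finset.single_le_sum (f := fun k => θ⁻¹ ^ k * ‖(A ^ k) x‖)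
      (fun k _ => by positivity) (Finset.mem_range.2 hN0)
    simpa [hq] using this
  · rw [hq, add_mul, Finset.sum_mul]
    refine (Finset.sum_le_sum fun k _ => ?_).trans (le_add_of_nonneg_right (by positivity))
    rw [mul_assoc]
    gcongr
    exact (A ^ k).le_opNorm x
  · have h1 := Finset.sum_range_succ (fun k => θ⁻¹ ^ k * ‖(A ^ k) x‖) N
    have h2 := Finset.sum_range_succ' (fun k => θ⁻¹ ^ k * ‖(A ^ k) x‖) N
    have h3 : q (A x) = θ * ∑ k ∈ Finset.range N, θ⁻¹ ^ (k + 1) * ‖(A ^ (k + 1)) x‖ := by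
      rw [hq, Finset.mul_sum]
      refine Finset.sum_congr rfl fun k _ => ?_
      rw [pow_succ A k, pow_succ θ⁻¹ k, mul_apply_eq_comp]
      field_simp
    have h4 : θ⁻¹ ^ N * ‖(A ^ N) x‖ ≤ ‖x‖ := by
      calc θ⁻¹ ^ N * ‖(A ^ N) x‖ ≤ θ⁻¹ ^ N * (θ ^ N * ‖x‖) := by
            gcongr
            exact (A ^ N).le_of_opNorm_le hAN x
        _ = ‖x‖ := by rw [← mul_assoc, ← mul_pow, inv_mul_cancel₀ hθ0.ne', one_pow, one_mul]
    rw [h3]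
    gcongr
    rw [hq]
    simp only [pow_zero, one_apply_eq_self, one_mul] at h2
    linarith

lemma tendsto_zero_of_le_contraction {u b : ℕ → ℝ} {a : ℝ} (ha : 0 ≤ a) (ha1 : a < 1)
    (hu : ∀ k, 0 ≤ u k) (hub : ∀ k, u (k + 1) ≤ a * u k + b k) (hb : Tendsto b atTop (𝓝 0)) :
    Tendsto u atTop (𝓝 0) := by
  rw [Metric.tendsto_atTop]
  intro ε hε
  have hpos : 0 < (1 - a) * (ε / 2) := mul_pos (by linarith) (by linarith)
  obtain ⟨K, hK⟩ := eventually_atTop.1 (hb.eventually (gt_mem_nhds hpos))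
  have hbound : ∀ m, u (K + m) ≤ a ^ m * u K + ε / 2 := by
    intro m
    induction m with
    | zero => simp; linarith
    | succ m ih =>
      have h1 := hub (K + m)
      have h2 := hK (K + m) (by omega)
      have h3 := mul_le_mul_of_nonneg_left ih ha
      rw [← add_assoc, pow_succ]
      nlinarith
  have hlim : Tendsto (fun m => a ^ m * u K) atTop (𝓝 0) := by
    simpa using (tendsto_pow_atTop_nhds_zero_of_lt_one ha ha1).mul_const (u K)
  obtain ⟨M, hM⟩ := eventually_atTop.1 (hlim.eventually (gt_mem_nhds (half_pos hε)))
  refine ⟨K + M, fun k hk => ?_⟩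
  have h1 := hbound (k - K)
  have h2 := hM (k - K) (by omega)
  rw [Nat.add_sub_cancel' (by omega)] at h1
  rw [Real.dist_eq, sub_zero, abs_of_nonneg (hu k)]
  linarith

/-- A sequence whose distance to a subspace is eventually contracted, up to a vanishing error,
converges to that subspace. -/
lemma exists_mem_tendsto_sub {E : Type*} [NormedAddCommGroup E] [NormedSpace ℝ E]
    {q : Seminorm ℝ E} (hq : ∀ x, ‖x‖ ≤ q x) {S : Submodule ℝ E} {X : ℕ → E} {a : ℝ} {b : ℕ → ℝ}
    (ha : 0 ≤ a) (ha1 : a < 1) (hb : Tendsto b atTop (𝓝 0))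
    (hstep : ∀ᶠ k in atTop, ∀ V ∈ S, ∃ V' ∈ S, q (X (k + 1) - V') ≤ a * q (X k - V) + b k) :
    ∃ V : ℕ → E, (∀ k, V k ∈ S) ∧ Tendsto (fun k => X k - V k) atTop (𝓝 0) := by
  obtain ⟨K, hK⟩ := eventually_atTop.1 hstep
  have hK' : ∀ k : ℕ, ∀ V : S, ∃ V' : S,
      q (X (k + K + 1) - V') ≤ a * q (X (k + K) - V) + b (k + K) := fun k V => by
    obtain ⟨V', h1, h2⟩ := hK (k + K) (by omega) V V.2
    exact ⟨⟨V', h1⟩, h2⟩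
  choose F hF using hK'
  let V : ℕ → S := Nat.rec (0 : S) F
  have hlim : Tendsto (fun k => q (X (k + K) - (V k).1)) atTop (𝓝 0) := by
    refine tendsto_zero_of_le_contraction ha ha1 (fun k => apply_nonneg q _) (fun k => ?_)
      ((tendsto_add_atTop_iff_nat K).2 hb)
    have := hF k (V k)
    rwa [show k + K + 1 = k + 1 + K by omega] at this
  refine ⟨fun k => (V (k - K)).1, fun k => (V (k - K)).2, ?_⟩
  rw [← tendsto_add_atTop_iff_nat K]
  simp only [Nat.add_sub_cancel]
  exact squeeze_zero_norm (fun k => hq _) hlim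

end contraction

section class_maps

variable {g : Type*} [NormedAddCommGroup g] [NormedSpace ℝ g] [FiniteDimensional ℝ g]
  {B : g →ₗ[ℝ] g →ₗ[ℝ] g} {n r : ℕ} {A : (Fin n → g) →L[ℝ] (Fin n → g)}
  {c : Word (n + r) → Fin n → ℝ} {f : (Fin n → g) → (Fin r → g) → (Fin n → g)}

lemma tsum_mem_submodule (L : Submodule ℝ g) {ι : Type*} {F : ι → g} (hF : ∀ i, F i ∈ L) :
    ∑' i, F i ∈ L :=
  tsum_mem L.closed_of_finiteDimensional hF

lemma sub_linear_mem_of_derived_le {h : Submodule ℝ g} (hDer : bSpan B ⊤ ⊤ ≤ h)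
    (hfdef : ∀ X W j, f X W j = A X j + ∑' ω : Word (n + r), c ω j • wordEval B (letter X W) ω.1)
    (X : Fin n → g) (W : Fin r → g) (j : Fin n) : f X W j - A X j ∈ h := by
  rw [hfdef, add_sub_cancel_left]
  exact tsum_mem_submodule _ fun ω => h.smul_mem _ (wordEval_mem_of_derived_le hDer _ ω)

lemma nonlinear_sub_mem (hBalt : ∀ x : g, B x x = 0)
    (hsum : ∀ (X : Fin n → g) (W : Fin r → g) (j : Fin n),
      Summable (fun ω : Word (n + r) => ‖c ω j • wordEval B (letter X W) ω.1‖))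
    (hfdef : ∀ X W j, f X W j = A X j + ∑' ω : Word (n + r), c ω j • wordEval B (letter X W) ω.1)
    {L : Submodule ℝ g} (hL : ∀ x, ∀ y ∈ L, B x y ∈ L) {X Y : Fin n → g} (W : Fin r → g)
    (hXY : ∀ j, (X - Y) j ∈ L) (j : Fin n) : (f X W - f Y W - A (X - Y)) j ∈ L := by
  have := FiniteDimensional.complete ℝ g
  have e : (f X W - f Y W - A (X - Y)) j
      = ∑' ω : Word (n + r), c ω j •
        (wordEval B (letter X W) ω.1 - wordEval B (letter Y W) ω.1) := by
    simp only [smul_sub]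
    rw [(hsum X W j).of_norm.tsum_sub (hsum Y W j).of_norm]
    simp only [Pi.sub_apply, hfdef, map_sub]
    abel
  rw [e]
  refine tsum_mem_submodule _ fun ω => L.smul_mem _ (wordEval_sub_mem hBalt hL (fun i => ?_) _)
  rw [letter_sub]
  unfold letter
  split
  · exact hXY _
  · simp

lemma increment_mem (hBalt : ∀ x : g, B x x = 0)
    (hBjac : ∀ x y z : g, B x (B y z) = B (B x y) z + B y (B x z))
    (hsum : ∀ (X : Fin n → g) (W : Fin r → g) (j : Fin n),
      Summable (fun ω : Word (n + r) => ‖c ω j • wordEval B (letter X W) ω.1‖))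
    (hfdef : ∀ X W j, f X W j = A X j + ∑' ω : Word (n + r), c ω j • wordEval B (letter X W) ω.1)
    {h L : Submodule ℝ g} (hh : ∀ x, ∀ y ∈ h, B x y ∈ h)
    (hL : ∀ x, ∀ y ∈ L, B x y ∈ L) (hLh : L ≤ h) {Z : Fin n → g} (Y : Fin n → g)
    {W W' : Fin r → g} (hZ : ∀ j, Z j ∈ L) (hW : ∀ j, (W - W') j ∈ h) (t : ℝ) (j : Fin n) :
    (t • (f (Z + Y) W - f Y W) - (f (t • Z + Y) W' - f Y W')) j ∈ bSpan B L h := by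
  have := FiniteDimensional.complete ℝ g
  have e : (t • (f (Z + Y) W - f Y W) - (f (t • Z + Y) W' - f Y W')) j
      = ∑' ω : Word (n + r), c ω j •
        (t • (wordEval B (letter (Z + Y) W) ω.1 - wordEval B (letter Y W) ω.1)
          - (wordEval B (letter (t • Z + Y) W') ω.1 - wordEval B (letter Y W') ω.1)) := by
    have s := fun X W => (hsum X W j).of_norm
    simp only [smul_sub, smul_comm (c _ j) t]
    rw [(((s _ _).const_smul t).sub ((s _ _).const_smul t)).tsum_sub ((s _ _).sub (s _ _)),
      ((s _ _).const_smul t).tsum_sub ((s _ _).const_smul t), (s _ _).tsum_sub (s _ _),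
      (s _ _).tsum_const_smul, (s _ _).tsum_const_smul]
    simp only [Pi.sub_apply, Pi.smul_apply, Pi.add_apply, hfdef, map_add, map_smul]
    module
  rw [e]
  refine tsum_mem_submodule _ fun ω => Submodule.smul_mem _ _ ?_
  rw [letter_add, letter_add, letter_smul]
  refine wordEval_increment_mem hBalt hBjac hh hL hLh (fun i => ?_) (fun i => ?_) t _
  · unfold letter
    split
    · exact hZ _
    · simp
  · rw [letter_sub]
    unfold letter
    split
    · simp
    · exact hW _

/-- Along directions in an ideal `L ⊆ h`, the map `f` agrees modulo `[L, h]` with its linear part,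
up to a small relative error that is uniform in the size of the direction. -/
lemma exists_approx_linear_mod (hBalt : ∀ x : g, B x x = 0)
    (hBjac : ∀ x y z : g, B x (B y z) = B (B x y) z + B y (B x z))
    (hsum : ∀ (X : Fin n → g) (W : Fin r → g) (j : Fin n),
      Summable (fun ω : Word (n + r) => ‖c ω j • wordEval B (letter X W) ω.1‖))
    (hfdef : ∀ X W j, f X W j = A X j + ∑' ω : Word (n + r), c ω j • wordEval B (letter X W) ω.1)
    (hf0 : ∀ W, f 0 W = 0)
    {h L : Submodule ℝ g} (hh : ∀ x, ∀ y ∈ h, B x y ∈ h)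
    (hL : ∀ x, ∀ y ∈ L, B x y ∈ L) (hLh : L ≤ h) {η δ : ℝ} (hδ : 0 < δ)
    (hlip : ∀ (X Y : Fin n → g) (W : Fin r → g), ‖X‖ ≤ δ → ‖Y‖ ≤ δ → ‖W‖ ≤ δ →
      ‖f X W - f Y W - A (X - Y)‖ ≤ η * ‖X - Y‖)
    {Z Y : Fin n → g} {W W' : Fin r → g} (hZ : ∀ j, Z j ∈ L) (hWW : ∀ j, (W - W') j ∈ h)
    (hY : ‖Y‖ ≤ δ / 2) (hW : ‖W‖ ≤ δ) (hW' : ‖W'‖ ≤ δ) :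
    ∃ U : Fin n → g, (∀ j, U j ∈ bSpan B L h) ∧
      ‖f (Z + Y) W - U - A (Z + Y)‖ ≤ η * (‖Z‖ + ‖Y‖) := by
  set t : ℝ := δ / 2 / (‖Z‖ + 1) with ht
  have htpos : 0 < t := by positivity
  have htZ : ‖t • Z‖ ≤ δ / 2 := by
    rw [norm_smul, Real.norm_of_nonneg htpos.le, ht, div_mul_eq_mul_div,
      div_le_iff₀ (by positivity)]
    nlinarith [norm_nonneg Z]
  refine ⟨t⁻¹ • (t • (f (Z + Y) W - f Y W) - (f (t • Z + Y) W' - f Y W')),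
    fun j => Submodule.smul_mem _ _
      (increment_mem hBalt hBjac hsum hfdef hh hL hLh Y hZ hWW t j), ?_⟩
  have h1 := hlip Y 0 W (by linarith) (by simpa using hδ.le) hW
  have h2 := hlip (t • Z + Y) Y W' ((norm_add_le _ _).trans (by linarith)) (by linarith) hW'
  rw [hf0, sub_zero, sub_zero] at h1
  rw [add_sub_cancel_right, norm_smul, Real.norm_of_nonneg htpos.le] at h2
  have e : f (Z + Y) W - t⁻¹ • (t • (f (Z + Y) W - f Y W) - (f (t • Z + Y) W' - f Y W'))
        - A (Z + Y)
      = (f Y W - A Y) + t⁻¹ • (f (t • Z + Y) W' - f Y W' - A (t • Z)) := by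
    simp only [map_add, map_smul, smul_sub, smul_smul, inv_mul_cancel₀ htpos.ne', one_smul]
    abel
  rw [e]
  refine (norm_add_le _ _).trans ?_
  have h3 : ‖t⁻¹ • (f (t • Z + Y) W' - f Y W' - A (t • Z))‖ ≤ η * ‖Z‖ := by
    rw [norm_smul, Real.norm_of_nonneg (inv_pos.2 htpos).le, inv_mul_le_iff₀ htpos]
    linarith
  linarith

end class_maps

/-- Vanishing distance to `h^r` gives a vanishing representative modulo `h^r`. -/
lemma exists_tendsto_zero_of_dist {g : Type*} [NormedAddCommGroup g] [NormedSpace ℝ g] {r : ℕ}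
    {h : Submodule ℝ g} {W : ℕ → Fin r → g}
    (hW : Filter.Tendsto
      (fun k => ⨅ V : {V : Fin r → g // ∀ j, V j ∈ h}, pnorm (W k - V.1))
      Filter.atTop (nhds 0)) :
    ∃ W' : ℕ → Fin r → g, (∀ k j, (W k - W' k) j ∈ h) ∧
      Filter.Tendsto W' Filter.atTop (nhds 0) := by
  have hex : ∀ k : ℕ, ∃ V : {V : Fin r → g // ∀ j, V j ∈ h}, pnorm (W k - V.1) <
      (⨅ V : {V : Fin r → g // ∀ j, V j ∈ h}, pnorm (W k - V.1)) + 1 / ((k : ℝ) + 1) := fun k => by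
    have : Nonempty {V : Fin r → g // ∀ j, V j ∈ h} := ⟨⟨0, fun j => h.zero_mem⟩⟩
    exact exists_lt_of_ciInf_lt (lt_add_of_pos_right _ (by positivity))
  choose V hV using hex
  refine ⟨fun k => W k - (V k).1, fun k j => by simpa using (V k).2 j, ?_⟩
  refine squeeze_zero_norm (fun k => (norm_le_pnorm _).trans (hV k).le) ?_
  simpa using hW.add tendsto_one_div_add_atTop_nhds_zero_nat

/-- Solvable case: there is `β > 0` such that for every exogenous signal `W`
with `dist(W[k], h^r) → 0` and `‖W[k]‖ ≤ β` for all `k`, the origin is globally asymptotically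
stable: Lyapunov stable and every solution converges to `0`. -/
theorem statement3
    {g : Type*} [NormedAddCommGroup g] [NormedSpace ℝ g] [FiniteDimensional ℝ g]
    (B : g →ₗ[ℝ] g →ₗ[ℝ] g)
    (hBalt : ∀ x : g, B x x = 0)
    (hBjac : ∀ x y z : g, B x (B y z) = B (B x y) z + B y (B x z))
    (μ : ℝ) (hμpos : 0 < μ) (hμ : ∀ x y : g, ‖B x y‖ ≤ μ * ‖x‖ * ‖y‖)
    (n r : ℕ) (hn : 1 ≤ n) (hr : 1 ≤ r)
    -- `g` is solvable
    (hsolv : ∃ v, derSeries B v = ⊥)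
    -- `h` is an ideal containing the derived algebra `[g,g]`
    (h : Submodule ℝ g)
    (hIdeal : ∀ (x : g), ∀ y ∈ h, B x y ∈ h)
    (hDer : bSpan B (⊤ : Submodule ℝ g) (⊤ : Submodule ℝ g) ≤ h)
    -- `h` is nilpotent with nilindex `p`
    (p : ℕ) (hnilp : lcs B h p = ⊥) (hleast : ∀ q, lcs B h q = ⊥ → p ≤ q)
    -- `f` belongs to class-𝒜 with linear part `A` and coefficients `c`
    (A : (Fin n → g) →L[ℝ] (Fin n → g))
    (c : Word (n + r) → Fin n → ℝ)
    (f : (Fin n → g) → (Fin r → g) → (Fin n → g))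
    (hsum : ∀ (X : Fin n → g) (W : Fin r → g) (j : Fin n),
      Summable (fun ω : Word (n + r) => ‖c ω j • wordEval B (letter X W) ω.1‖))
    (hfdef : ∀ X W j, f X W j = A X j + ∑' ω : Word (n + r), c ω j • wordEval B (letter X W) ω.1)
    (hclassA : ∃ ε > 0, ∀ (X : Fin n → g) (W : Fin r → g), pnorm X + pnorm W < ε →
      Summable (fun ω : Word (n + r) =>
        μ ^ (ω.1.length - 1) * ‖c ω‖ * (ω.1.map fun i => ‖letter X W i‖).prod))
    -- (i) the origin is the unique equilibrium
    (heq : ∀ (W : Fin r → g) (X : Fin n → g), f X W = 0 ↔ X = 0)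
    -- (ii) each `(h^(i))^n` is invariant under `f`
    (hinv : ∀ (i : ℕ) (X : Fin n → g) (W : Fin r → g),
      (∀ j, X j ∈ lcs B h i) → ∀ j, f X W j ∈ lcs B h i)
    -- `A` is Schur
    (hρ : specRad A < 1) :
    ∃ β > (0 : ℝ), ∀ W : ℕ → Fin r → g,
      -- `dist(W[k], h^r) → 0`
      Filter.Tendsto
        (fun k => ⨅ V : {V : Fin r → g // ∀ j, V j ∈ h}, pnorm (W k - V.1))
        Filter.atTop (nhds 0) →
      -- `‖W[k]‖ ≤ β` for all `k`
      (∀ k, pnorm (W k) ≤ β) →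
      -- Lyapunov stability of the origin …
      ((∀ ε > (0 : ℝ), ∃ δ > (0 : ℝ), ∀ X : ℕ → Fin n → g,
          (∀ k, X (k + 1) = f (X k) (W k)) → pnorm (X 0) ≤ δ → ∀ k, pnorm (X k) ≤ ε) ∧
        -- … and global attractivity of the origin
        (∀ X : ℕ → Fin n → g, (∀ k, X (k + 1) = f (X k) (W k)) →
          Filter.Tendsto X Filter.atTop (nhds 0))) := by
  have := FiniteDimensional.complete ℝ g
  obtain ⟨q, C, θ, hC, hθ, hθ1, hq1, hq2, hqA⟩ := exists_adapted_norm A hρ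
  set η : ℝ := (1 - θ) / (2 * C) with hη
  have hηpos : 0 < η := div_pos (by linarith) (by positivity)
  set a : ℝ := θ + C * η with ha
  have ha0 : 0 ≤ a := by positivity
  have ha1 : a < 1 := by
    have : C * η = (1 - θ) / 2 := by rw [hη]; field_simp
    linarith
  have hθa : θ ≤ a := le_add_of_nonneg_right (by positivity)
  obtain ⟨δ, hδ, hlip⟩ := exists_lipschitz_nonlinear hμpos hμ hsum hfdef hclassA hηpos
  have hf0 : ∀ W, f 0 W = 0 := fun W => (heq W 0).2 rfl
  have hLi := lcs_ideal hBjac hIdeal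
  have hAinv : ∀ i (V : Fin n → g), (∀ j, V j ∈ lcs B h i) → ∀ j, A V j ∈ lcs B h i := by
    intro i V hV j
    have h1 := nonlinear_sub_mem hBalt hsum hfdef (hLi i) (Y := 0) 0 (by simpa using hV) j
    have h2 := sub_mem (hinv i V 0 hV j) h1
    simpa [hf0] using h2
  have hdesc : ∀ i, lcs B h (i + 1) ≤ lcs B h i := fun i => by
    refine Submodule.span_le.2 ?_
    rintro _ ⟨x, hx, y, -, rfl⟩
    rw [bracket_swap hBalt]
    exact neg_mem (hLi i y x hx)
  refine ⟨δ, hδ, fun W hWlim hWβ => ⟨fun ε hε => ?_, fun X hX => ?_⟩⟩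
  · -- near the origin `q` is a Lyapunov function
    have hm : 0 < min δ (ε / n) := lt_min hδ (div_pos hε (by exact_mod_cast hn))
    refine ⟨min δ (ε / n) / C, div_pos hm hC, fun X hX hX0 => ?_⟩
    have hstay : ∀ k, q (X k) ≤ min δ (ε / n) := by
      intro k
      induction k with
      | zero =>
        refine (hq2 _).trans ?_
        rw [mul_comm, ← le_div_iff₀ hC]
        exact (norm_le_pnorm _).trans hX0
      | succ k ih =>
        have h1 := hlip (X k) 0 (W k) ((hq1 _).trans (ih.trans (min_le_left _ _)))
          (by simpa using hδ.le) ((norm_le_pnorm _).trans (hWβ k))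
        rw [hf0, sub_zero, sub_zero] at h1
        calc q (X (k + 1)) = q (A (X k) + (f (X k) (W k) - A (X k))) := by rw [hX]; simp
          _ ≤ q (A (X k)) + q (f (X k) (W k) - A (X k)) := map_add_le_add _ _ _
          _ ≤ θ * q (X k) + C * (η * q (X k)) := by
            refine add_le_add (hqA _) ((hq2 _).trans ?_)
            gcongr
            exact h1.trans (by gcongr; exact hq1 _)
          _ = a * q (X k) := by ring
          _ ≤ 1 * q (X k) := mul_le_mul_of_nonneg_right ha1.le (apply_nonneg _ _)
          _ ≤ _ := by rwa [one_mul]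
    intro k
    have hn0 : (0 : ℝ) < n := by exact_mod_cast hn
    calc pnorm (X k) ≤ n * ‖X k‖ := pnorm_le _
      _ ≤ n * (ε / n) := by
        gcongr
        exact (hq1 _).trans ((hstay k).trans (min_le_right _ _))
      _ = ε := by field_simp
  · obtain ⟨W', hWW, hW'⟩ := exists_tendsto_zero_of_dist hWlim
    have hS : ∀ i (V : Fin n → g), V ∈ Submodule.pi Set.univ (fun _ : Fin n => lcs B h i) ↔
        ∀ j, V j ∈ lcs B h i := fun i V => by simp [Submodule.mem_pi]
    have hconv : ∀ i, ∃ V : ℕ → Fin n → g,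
        (∀ k, V k ∈ Submodule.pi Set.univ (fun _ : Fin n => lcs B h i)) ∧
        Filter.Tendsto (fun k => X k - V k) Filter.atTop (nhds 0) := by
      intro i
      induction i with
      | zero =>
        refine exists_mem_tendsto_sub hq1 (b := fun _ => 0) ha0 ha1 tendsto_const_nhds
          (Filter.Eventually.of_forall fun k V hV => ?_)
        rw [hS] at hV
        refine ⟨f (X k) (W k) - A (X k) + A V, (hS _ _).2 fun j => ?_, ?_⟩
        · exact add_mem (sub_linear_mem_of_derived_le hDer hfdef _ _ j) (hAinv 0 V hV j)
        · have e : X (k + 1) - (f (X k) (W k) - A (X k) + A V) = A (X k - V) := by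
            rw [hX, map_sub]
            abel
          rw [e, add_zero]
          exact (hqA _).trans (mul_le_mul_of_nonneg_right hθa (apply_nonneg _ _))
      | succ i ih =>
        obtain ⟨Z, hZ, hY⟩ := ih
        have hYn : Filter.Tendsto (fun k => ‖X k - Z k‖) Filter.atTop (nhds 0) := by
          simpa using hY.norm
        have hWn : Filter.Tendsto (fun k => ‖W' k‖) Filter.atTop (nhds 0) := by
          simpa using hW'.norm
        refine exists_mem_tendsto_sub hq1 (b := fun k => 2 * C * η * ‖X k - Z k‖) ha0 ha1
          (by simpa using hYn.const_mul (2 * C * η)) ?_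
        filter_upwards [hYn.eventually (gt_mem_nhds (half_pos hδ)),
          hWn.eventually (gt_mem_nhds hδ)] with k hk1 hk2 V hV
        rw [hS] at hV
        have hZV : ∀ j, (Z k - V) j ∈ lcs B h i := fun j =>
          sub_mem ((hS _ _).1 (hZ k) j) (hdesc i (hV j))
        obtain ⟨U, hU, hUe⟩ := exists_approx_linear_mod hBalt hBjac hsum hfdef hf0 hIdeal (hLi i)
          (lcs_le hIdeal i) hδ hlip hZV (hWW k) hk1.le ((norm_le_pnorm _).trans (hWβ k)) hk2.le
        rw [show Z k - V + (X k - Z k) = X k - V by abel] at hUe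
        have hshift : ∀ j, (f (X k) (W k) - f (X k - V) (W k)) j ∈ lcs B h (i + 1) := fun j => by
          have h1 := nonlinear_sub_mem hBalt hsum hfdef (hLi (i + 1)) (X := X k) (Y := X k - V)
            (W k) (by simpa using hV) j
          have h2 := add_mem h1 (hAinv (i + 1) V hV j)
          simpa using h2
        refine ⟨f (X k) (W k) - f (X k - V) (W k) + U,
          (hS _ _).2 fun j => add_mem (hshift j) (hU j), ?_⟩
        have hZle : ‖Z k - V‖ ≤ q (X k - V) + ‖X k - Z k‖ := by
          rw [show Z k - V = (X k - V) - (X k - Z k) by abel]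
          exact (norm_sub_le _ _).trans (add_le_add_left (hq1 _) _)
        calc q (X (k + 1) - (f (X k) (W k) - f (X k - V) (W k) + U))
            = q (A (X k - V) + (f (X k - V) (W k) - U - A (X k - V))) := by
              rw [hX]
              congr 1
              abel
          _ ≤ q (A (X k - V)) + q (f (X k - V) (W k) - U - A (X k - V)) := map_add_le_add _ _ _
          _ ≤ θ * q (X k - V) + C * (η * (q (X k - V) + ‖X k - Z k‖ + ‖X k - Z k‖)) := by
              refine add_le_add (hqA _) ((hq2 _).trans ?_)
              gcongr
              exact hUe.trans (by gcongr)
          _ = a * q (X k - V) + 2 * C * η * ‖X k - Z k‖ := by ring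
    obtain ⟨V, hV, hlim⟩ := hconv p
    have hV0 : ∀ k, V k = 0 := fun k => by
      funext j
      simpa [hnilp] using (hS _ _).1 (hV k) j
    simpa [hV0] using hlim
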